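/- Let M = ℕ ⊕ Set ℕ (the disjoint sum of ℕ and the powerset of ℕ, with injections inl and inr). Let R : M → M → Prop satisfy R (inl n) (inr A) ↔ n ∈ A for all n ∈ ℕ and A ⊆ ℕ, and let F : M → M → M satisfy F (inr A) (inr B) = F (inr B) (inr A) ∈ range(inr) for all A, B ⊆ ℕ. Let P₂ = range(inr) ⊆ M. Then for all ultrafilters D₁ ≠ D₂ on M with range(inl) ∈ D₁ and range(inl) ∈ D₂, there exists A ⊆ ℕ such that, setting E = pure (inr A): (i) P₂ ∈ E and for every ultrafilter E' on M with P₂ ∈ E', F̃(E, E') = F̃(E', E); (ii) R̃(D₁, E) holds; and (iii) R̃(D₂, E) fails. (This is the semantic content of the fact that the ultrafilter extension of the model M₁ satisfies the sentence ψ.) -/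

import Mathlib

/-- The ultrafilter extension of a binary operation `F : M → M → M`:
`A ∈ ext2 F D₁ D₂` iff `{a | {b | F a b ∈ A} ∈ D₂} ∈ D₁`. -/
def ext2 {M : Type*} (F : M → M → M) (D₁ D₂ : Ultrafilter M) : Ultrafilter M :=
  D₁.bind fun a => Ultrafilter.map (F a) D₂

/-- The ultrafilter extension of a binary relation `R : M → M → Prop`:
`extRel R D₁ D₂` iff `{a | {b | R a b} ∈ D₂} ∈ D₁`. -/
def extRel {M : Type*} (R : M → M → Prop) (D₁ D₂ : Ultrafilter M) : Prop :=
  {a : M | {b : M | R a b} ∈ D₂} ∈ D₁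

theorem mem_ext2 {M : Type*} {F : M → M → M} {D₁ D₂ : Ultrafilter M} {X : Set M} :
    X ∈ ext2 F D₁ D₂ ↔ {a | {b | F a b ∈ X} ∈ D₂} ∈ D₁ :=
  Iff.rfl

theorem ext2_pure_comm {M : Type*} {F : M → M → M} {a : M} {D : Ultrafilter M}
    (h : {b | F a b = F b a} ∈ D) : ext2 F (pure a) D = ext2 F D (pure a) := by
  ext X
  simp only [mem_ext2, Ultrafilter.mem_pure, Set.mem_ofPred_eq]
  refine Filter.eventually_congr (f := (D : Filter M)) ?_
  filter_upwards [h] with b hb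
  rw [show F a b = F b a from hb]

theorem extRel_pure_iff {M : Type*} {R : M → M → Prop} {D : Ultrafilter M} {b : M} :
    extRel R D (pure b) ↔ {a | R a b} ∈ D :=
  Iff.rfl

theorem Ultrafilter.exists_mem_notMem_of_ne {α : Type*} {D₁ D₂ : Ultrafilter α} (h : D₁ ≠ D₂) :
    ∃ S ∈ D₁, S ∉ D₂ := by
  by_contra! hS
  exact h (Ultrafilter.eq_of_le (f := D₂) (g := D₁) hS).symm

/-- Semantic content of `β(M₁) ⊨ ψ`: on `M = ℕ ⊕ Set ℕ`, with `R` extending membership and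
`F` commuting on (and preserving) the range of `inr`, any two distinct ultrafilters
concentrated on the range of `inl` are separated by a principal ultrafilter `pure (inr A)`
which is central with respect to `F̃`. -/
theorem ultrafilter_extension_satisfies_psi
    (R : (ℕ ⊕ Set ℕ) → (ℕ ⊕ Set ℕ) → Prop)
    (F : (ℕ ⊕ Set ℕ) → (ℕ ⊕ Set ℕ) → (ℕ ⊕ Set ℕ))
    (hR : ∀ (n : ℕ) (A : Set ℕ), R (Sum.inl n) (Sum.inr A) ↔ n ∈ A)
    (hFcomm : ∀ A B : Set ℕ, F (Sum.inr A) (Sum.inr B) = F (Sum.inr B) (Sum.inr A))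
    (hFrange : ∀ A B : Set ℕ,
      F (Sum.inr A) (Sum.inr B) ∈ Set.range (Sum.inr : Set ℕ → ℕ ⊕ Set ℕ))
    (D₁ D₂ : Ultrafilter (ℕ ⊕ Set ℕ)) (hne : D₁ ≠ D₂)
    (h1 : Set.range (Sum.inl : ℕ → ℕ ⊕ Set ℕ) ∈ D₁)
    (h2 : Set.range (Sum.inl : ℕ → ℕ ⊕ Set ℕ) ∈ D₂) :
    ∃ A : Set ℕ,
      (Set.range (Sum.inr : Set ℕ → ℕ ⊕ Set ℕ) ∈
        (pure (Sum.inr A) : Ultrafilter (ℕ ⊕ Set ℕ))) ∧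
      (∀ E' : Ultrafilter (ℕ ⊕ Set ℕ), Set.range (Sum.inr : Set ℕ → ℕ ⊕ Set ℕ) ∈ E' →
        ext2 F (pure (Sum.inr A)) E' = ext2 F E' (pure (Sum.inr A))) ∧
      extRel R D₁ (pure (Sum.inr A)) ∧
      ¬ extRel R D₂ (pure (Sum.inr A)) := by
  obtain ⟨S, hS₁, hS₂⟩ := Ultrafilter.exists_mem_notMem_of_ne hne
  refine ⟨Sum.inl ⁻¹' S, Ultrafilter.mem_pure.2 ⟨_, rfl⟩, fun E' hE' => ext2_pure_comm ?_, ?_, ?_⟩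
  · filter_upwards [hE']
    rintro _ ⟨B, rfl⟩
    exact hFcomm _ B
  · rw [extRel_pure_iff]
    filter_upwards [h1, hS₁]
    rintro _ ⟨n, rfl⟩ hn
    exact (hR _ _).2 hn
  · rw [extRel_pure_iff]
    refine fun h => hS₂ ?_
    filter_upwards [h2, h]
    rintro _ ⟨n, rfl⟩ hn
    exact (hR _ _).1 hn
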